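/- arXiv:math-ph/0109018 — 6 statements merged into one kernel-verified Lean document; each statement's English description precedes it below -/
import Mathlib

section
/- For every n ∈ ℕ, the integral ∫_ℝ V'(x) ψ_n(x)² dx equals 0 (the diagonal string equation V'(Q)_{n,n} = 0). -/
open MeasureTheory Polynomial Real

/-- Each member of an orthogonal family of monic polynomials with `(p n).natDegree = n` is
orthogonal to every polynomial of smaller degree. -/
theorem integral_mul_eq_zero_of_degree_lt {w : ℝ → ℝ}
    (hint : ∀ q : Polynomial ℝ, Integrable (fun x : ℝ => q.eval x * w x))
    {p : ℕ → Polynomial ℝ} (hmonic : ∀ n, (p n).Monic) (hpdeg : ∀ n, (p n).natDegree = n)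
    (horth : ∀ n m, n ≠ m → ∫ x : ℝ, (p n).eval x * (p m).eval x * w x = 0)
    {n : ℕ} {q : Polynomial ℝ} (hq : q.degree < n) :
    ∫ x : ℝ, (p n * q).eval x * w x = 0 := by
  suffices H : ∀ d ≤ n, ∀ q : Polynomial ℝ, q.degree < d →
      ∫ x : ℝ, (p n * q).eval x * w x = 0 from H n le_rfl q hq
  intro d
  induction d with
  | zero =>
    intro _ q hq
    have hq0 : q = 0 := by simpa [Polynomial.degree_eq_bot] using hq
    simp [hq0]
  | succ d ih =>
    intro hd q hq
    have hcoeff : (p d).coeff d = 1 := by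
      simpa [hpdeg d] using (hmonic d).coeff_natDegree
    have hlt : (q - C (q.coeff d) * p d).degree < d := by
      rw [degree_lt_iff_coeff_zero]
      intro m hm
      rcases hm.eq_or_lt with rfl | hm
      · simp [hcoeff]
      · have hqm : q.coeff m = 0 := (degree_lt_iff_coeff_zero q (d + 1)).1 hq m hm
        have hpm : (p d).coeff m = 0 :=
          coeff_eq_zero_of_natDegree_lt (by rwa [hpdeg d])
        simp [hqm, hpm]
    have hsplit : ∀ x : ℝ, (p n * q).eval x * w x =
        (p n * (q - C (q.coeff d) * p d)).eval x * w x +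
          q.coeff d * ((p n).eval x * (p d).eval x * w x) := by
      intro x
      simp only [eval_mul, eval_sub, eval_C]
      ring
    have hprod : Integrable (fun x : ℝ => (p n).eval x * (p d).eval x * w x) := by
      simpa only [eval_mul] using hint (p n * p d)
    simp_rw [hsplit]
    rw [integral_add (hint _) (hprod.const_mul _), ih (by omega) _ hlt, integral_const_mul,
      horth n d (by omega)]
    simp

/-- Integration by parts against `exp (-V)`: the total derivative of `f * exp (-V)` integrates
to zero. -/
theorem integral_derivative_sub_mul_exp_neg_eq_zero {V : Polynomial ℝ}
    (hint : ∀ q : Polynomial ℝ,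
      Integrable (fun x : ℝ => q.eval x * Real.exp (-(V.eval x))))
    (f : Polynomial ℝ) :
    ∫ x : ℝ, (derivative f - f * derivative V).eval x * Real.exp (-(V.eval x)) = 0 := by
  refine integral_eq_zero_of_hasDerivAt_of_integrable (fun x => ?_) (hint _) (hint f)
  convert! (f.hasDerivAt x).mul (V.hasDerivAt x).neg.exp using 1
  simp only [eval_sub, eval_mul, Pi.neg_apply]
  ring

theorem stmt0
    (V : Polynomial ℝ)
    (hVeven : Even V.natDegree) (hVdeg : 2 ≤ V.natDegree)
    (hVlead : 0 < V.leadingCoeff)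
    (hint : ∀ q : Polynomial ℝ,
      Integrable (fun x : ℝ => q.eval x * Real.exp (-(V.eval x))))
    (p : ℕ → Polynomial ℝ)
    (hmonic : ∀ n, (p n).Monic)
    (hpdeg : ∀ n, (p n).natDegree = n)
    (horth : ∀ n m, n ≠ m →
      ∫ x : ℝ, (p n).eval x * (p m).eval x * Real.exp (-(V.eval x)) = 0)
    (h : ℕ → ℝ)
    (hh : ∀ n, h n = ∫ x : ℝ, ((p n).eval x) ^ 2 * Real.exp (-(V.eval x)))
    (hhpos : ∀ n, 0 < h n)
    (ψ : ℕ → ℝ → ℝ)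
    (hψ : ∀ n x, ψ n x = (p n).eval x * Real.exp (-(V.eval x) / 2) / Real.sqrt (h n))
    (n : ℕ) :
    ∫ x : ℝ, (derivative V).eval x * (ψ n x) ^ 2 = 0 := by
  have hparts := integral_derivative_sub_mul_exp_neg_eq_zero hint (p n ^ 2)
  have hdeg : (derivative (p n)).degree < n := by
    have := degree_derivative_lt (hmonic n).ne_zero
    rwa [degree_eq_natDegree (hmonic n).ne_zero, hpdeg n] at this
  have hlow := integral_mul_eq_zero_of_degree_lt hint hmonic hpdeg horth hdeg
  have hψsq : ∀ x : ℝ, (derivative V).eval x * (ψ n x) ^ 2 =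
      (h n)⁻¹ * (2 * ((p n * derivative (p n)).eval x * Real.exp (-(V.eval x))) -
        (derivative (p n ^ 2) - p n ^ 2 * derivative V).eval x * Real.exp (-(V.eval x))) := by
    intro x
    have hexp : Real.exp (-(V.eval x) / 2) ^ 2 = Real.exp (-(V.eval x)) := by
      rw [← Real.exp_nat_mul]
      congr 1
      push_cast
      ring
    rw [hψ, div_pow, mul_pow, hexp, Real.sq_sqrt (hhpos n).le]
    simp only [derivative_pow, eval_sub, eval_mul, eval_pow, eval_C]
    norm_num
    ring
  simp_rw [hψsq]
  rw [integral_const_mul, integral_sub ((hint _).const_mul 2) (hint _), integral_const_mul,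
    hlow, hparts]
  simp
end

section
/- For every n ≥ 1, ∫_ℝ V'(x) ψ_n(x) ψ_{n−1}(x) dx = n/γ_n (the off-diagonal string equation V'(Q)_{n,n−1} = n/γ_n). -/
open MeasureTheory Polynomial Real

/-- The expectation functional `q ↦ ∫ q(x) exp(-V(x)) dx` on polynomials. -/
noncomputable def expWeightFunctional (V : Polynomial ℝ)
    (hint : ∀ q : Polynomial ℝ, Integrable (fun x : ℝ => q.eval x * Real.exp (-(V.eval x)))) :
    Polynomial ℝ →ₗ[ℝ] ℝ where
  toFun q := ∫ x : ℝ, q.eval x * Real.exp (-(V.eval x))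
  map_add' q r := by
    simp only [eval_add, add_mul]
    exact integral_add (hint q) (hint r)
  map_smul' c q := by
    simp only [eval_smul, smul_eq_mul, mul_assoc, integral_const_mul, RingHom.id_apply]

theorem expWeightFunctional_derivative_mul (V : Polynomial ℝ)
    (hint : ∀ q : Polynomial ℝ, Integrable (fun x : ℝ => q.eval x * Real.exp (-(V.eval x))))
    (q : Polynomial ℝ) :
    expWeightFunctional V hint (derivative V * q) =
      expWeightFunctional V hint (derivative q) := by
  have key : expWeightFunctional V hint (derivative q - derivative V * q) = 0 := by
    refine integral_eq_zero_of_hasDerivAt_of_integrable (fun x => ?_) (hint _) (hint q)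
    refine ((q.hasDerivAt x).mul (V.hasDerivAt x).neg.exp).congr_deriv ?_
    simp only [eval_sub, eval_mul, Pi.neg_apply]
    ring
  rw [map_sub, sub_eq_zero] at key
  exact key.symm

theorem Polynomial.degree_sub_C_mul_monic_lt {q p : Polynomial ℝ} {k : ℕ} (hp : p.Monic)
    (hpk : p.natDegree = k) (hq : q.degree < (k + 1 : ℕ)) :
    (q - C (q.coeff k) * p).degree < k := by
  rw [degree_lt_iff_coeff_zero] at hq ⊢
  intro m hm
  rcases hm.eq_or_lt with rfl | hlt
  · have : p.coeff k = 1 := by rw [← hpk]; exact hp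
    simp [this]
  · simp [hq m hlt, coeff_eq_zero_of_natDegree_lt (hpk.trans_lt hlt)]

/-- If a functional kills `p m * p k` for `k < m`, it kills `p m * q` for all `q` of lower degree. -/
theorem LinearMap.map_monic_mul_eq_zero_of_degree_lt (L : Polynomial ℝ →ₗ[ℝ] ℝ)
    (p : ℕ → Polynomial ℝ) (hmonic : ∀ n, (p n).Monic) (hpdeg : ∀ n, (p n).natDegree = n)
    {m : ℕ} (horth : ∀ k < m, L (p m * p k) = 0) {k : ℕ} (hk : k ≤ m)
    {q : Polynomial ℝ} (hq : q.degree < k) : L (p m * q) = 0 := by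
  induction k generalizing q with
  | zero =>
    have : q = 0 := degree_eq_bot.mp (by simpa using hq)
    simp [this]
  | succ k ih =>
    have hr := ih (by omega) (degree_sub_C_mul_monic_lt (hmonic k) (hpdeg k) hq)
    have hdecomp : p m * (q - C (q.coeff k) * p k) = p m * q - q.coeff k • (p m * p k) := by
      rw [smul_eq_C_mul]; ring
    rw [hdecomp, map_sub, map_smul, horth k (by omega), smul_zero, sub_zero] at hr
    exact hr

theorem stmt1
    (V : Polynomial ℝ)
    (hVeven : Even V.natDegree) (hVdeg : 2 ≤ V.natDegree)
    (hVlead : 0 < V.leadingCoeff)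
    (hint : ∀ q : Polynomial ℝ,
      Integrable (fun x : ℝ => q.eval x * Real.exp (-(V.eval x))))
    (p : ℕ → Polynomial ℝ)
    (hmonic : ∀ n, (p n).Monic)
    (hpdeg : ∀ n, (p n).natDegree = n)
    (horth : ∀ n m, n ≠ m →
      ∫ x : ℝ, (p n).eval x * (p m).eval x * Real.exp (-(V.eval x)) = 0)
    (h : ℕ → ℝ)
    (hh : ∀ n, h n = ∫ x : ℝ, ((p n).eval x) ^ 2 * Real.exp (-(V.eval x)))
    (hhpos : ∀ n, 0 < h n)
    (ψ : ℕ → ℝ → ℝ)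
    (hψ : ∀ n x, ψ n x = (p n).eval x * Real.exp (-(V.eval x) / 2) / Real.sqrt (h n))
    (γ : ℕ → ℝ)
    (hγ : ∀ n, 1 ≤ n → γ n = Real.sqrt (h n / h (n - 1)))
    (n : ℕ) (hn : 1 ≤ n) :
    ∫ x : ℝ, (derivative V).eval x * ψ n x * ψ (n - 1) x = (n : ℝ) / γ n := by
  obtain ⟨k, rfl⟩ : ∃ k, n = k + 1 := ⟨n - 1, by omega⟩
  rw [hγ _ hn]
  simp only [Nat.add_sub_cancel]
  set L := expWeightFunctional V hint with hL
  have hLorth : ∀ m, ∀ j < m, L (p m * p j) = 0 := fun m j hj => by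
    simpa [hL, expWeightFunctional] using horth m j hj.ne'
  have hLnorm : L (p k * p k) = h k := by
    simp [hL, expWeightFunctional, hh, sq]
  have hdegk : (p k).degree = k := by
    rw [degree_eq_natDegree (hmonic k).ne_zero, hpdeg]
  have hlower : L (p (k + 1) * derivative (p k)) = 0 := by
    refine L.map_monic_mul_eq_zero_of_degree_lt p hmonic hpdeg (hLorth _) le_rfl ?_
    calc (derivative (p k)).degree ≤ (p k).degree := degree_derivative_le
      _ = (k : WithBot ℕ) := hdegk
      _ < ((k + 1 : ℕ) : WithBot ℕ) := by exact_mod_cast Nat.lt_succ_self k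
  have hcoeff : (derivative (p (k + 1))).coeff k = (k + 1 : ℕ) := by
    have : (p (k + 1)).coeff (k + 1) = 1 := by
      have := (hmonic (k + 1)).coeff_natDegree
      rwa [hpdeg] at this
    simp [coeff_derivative, this]
  have hupper : L (p k * derivative (p (k + 1))) = (k + 1 : ℕ) * h k := by
    have hdeg : (derivative (p (k + 1))).degree < (k + 1 : ℕ) := by
      have := degree_derivative_lt (hmonic (k + 1)).ne_zero
      rwa [degree_eq_natDegree (hmonic (k + 1)).ne_zero, hpdeg] at this
    have hr := L.map_monic_mul_eq_zero_of_degree_lt p hmonic hpdeg (hLorth k) le_rfl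
      (degree_sub_C_mul_monic_lt (hmonic k) (hpdeg k) hdeg)
    have hdecomp : ∀ c : ℝ, p k * (derivative (p (k + 1)) - C c * p k) =
        p k * derivative (p (k + 1)) - c • (p k * p k) := fun c => by
      rw [smul_eq_C_mul]; ring
    rw [hdecomp, map_sub, map_smul, hLnorm, hcoeff, sub_eq_zero, smul_eq_mul] at hr
    exact hr
  have hstring : L (derivative V * (p (k + 1) * p k)) = (k + 1 : ℕ) * h k := by
    rw [expWeightFunctional_derivative_mul, derivative_mul, map_add, hlower,
      mul_comm (derivative _), hupper, add_zero]
  have hnormalize : ∫ x : ℝ, (derivative V).eval x * ψ (k + 1) x * ψ k x =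
      L (derivative V * (p (k + 1) * p k)) / (√(h (k + 1)) * √(h k)) := by
    simp only [hL, expWeightFunctional, LinearMap.coe_mk, AddHom.coe_mk]
    rw [← integral_div]
    congr 1 with x
    have hexp : Real.exp (-(V.eval x)) =
        Real.exp (-(V.eval x) / 2) * Real.exp (-(V.eval x) / 2) := by
      rw [← Real.exp_add, add_halves]
    simp only [hψ, hexp, eval_mul]
    ring
  rw [hnormalize, hstring, Real.sqrt_div (hhpos _).le]
  have hk := Real.sqrt_pos.mpr (hhpos k)
  have hk' := Real.sqrt_pos.mpr (hhpos (k + 1))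
  field_simp
  rw [Real.sq_sqrt (hhpos k).le]
end

section
/- For all n, m ∈ ℕ: if m ≥ n then ∫_ℝ ψ_n'(x) ψ_m(x) dx = −(1/2) ∫_ℝ V'(x) ψ_n(x) ψ_m(x) dx, and if m ≤ n then ∫_ℝ ψ_n'(x) ψ_m(x) dx = +(1/2) ∫_ℝ V'(x) ψ_n(x) ψ_m(x) dx. (In matrix form, P = −(1/2)(V'(Q)_+ − V'(Q)_−).) -/
open MeasureTheory Polynomial Real

/-- Integration by parts against the weight `exp (-V)`. -/
theorem integral_derivative_mul_exp_neg (V : Polynomial ℝ)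
    (hint : ∀ q : Polynomial ℝ,
      Integrable (fun x : ℝ => q.eval x * Real.exp (-(V.eval x)))) (q : Polynomial ℝ) :
    ∫ x : ℝ, (derivative q).eval x * Real.exp (-(V.eval x))
      = ∫ x : ℝ, (derivative V * q).eval x * Real.exp (-(V.eval x)) := by
  have hderiv : ∀ x : ℝ, HasDerivAt (fun x : ℝ => q.eval x * Real.exp (-(V.eval x)))
      ((derivative q).eval x * Real.exp (-(V.eval x))
        - (derivative V * q).eval x * Real.exp (-(V.eval x))) x := by
    intro x
    refine ((q.hasDerivAt x).mul (V.hasDerivAt x).neg.exp).congr_deriv ?_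
    simp only [eval_mul, Pi.neg_apply]
    ring
  have hzero := integral_eq_zero_of_hasDerivAt_of_integrable hderiv
    ((hint (derivative q)).sub (hint (derivative V * q))) (hint q)
  rw [integral_sub (hint _) (hint _)] at hzero
  exact sub_eq_zero.mp hzero

/-- A monic orthogonal polynomial of degree `m` is orthogonal to every polynomial of smaller
degree. -/
theorem integral_mul_orthogonal_eq_zero (V : Polynomial ℝ)
    (hint : ∀ q : Polynomial ℝ,
      Integrable (fun x : ℝ => q.eval x * Real.exp (-(V.eval x))))
    (p : ℕ → Polynomial ℝ) (hmonic : ∀ n, (p n).Monic) (hpdeg : ∀ n, (p n).natDegree = n)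
    (horth : ∀ n m, n ≠ m →
      ∫ x : ℝ, (p n).eval x * (p m).eval x * Real.exp (-(V.eval x)) = 0)
    {m k : ℕ} (hkm : k ≤ m) (q : Polynomial ℝ) (hq : q.degree < k) :
    ∫ x : ℝ, (q * p m).eval x * Real.exp (-(V.eval x)) = 0 := by
  induction k generalizing q with
  | zero =>
    have : q = 0 := by simpa [degree_lt_iff_coeff_zero, Polynomial.ext_iff] using hq
    simp [this]
  | succ k ih =>
    set r := q - C (q.coeff k) * p k with hr
    have hrdeg : r.degree < k := by
      rw [degree_lt_iff_coeff_zero] at hq ⊢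
      intro j hj
      rcases hj.eq_or_lt with rfl | hj
      · have hlead : (p k).coeff k = 1 := by simpa [Monic, leadingCoeff, hpdeg] using hmonic k
        simp [hr, hlead]
      · have hpj : (p k).coeff j = 0 := coeff_eq_zero_of_natDegree_lt (by rwa [hpdeg])
        simp [hr, hq j hj, hpj]
    have hsplit : ∀ x : ℝ, (q * p m).eval x * Real.exp (-(V.eval x))
        = (r * p m).eval x * Real.exp (-(V.eval x))
          + q.coeff k * ((p k * p m).eval x * Real.exp (-(V.eval x))) := by
      intro x
      simp only [hr, eval_mul, eval_sub, eval_C]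
      ring
    simp_rw [hsplit]
    rw [integral_add (hint _) ((hint _).const_mul _), integral_const_mul,
      ih (by omega) r hrdeg]
    simp only [eval_mul]
    rw [horth k m (by omega)]
    simp

theorem stmt3
    (V : Polynomial ℝ)
    (hVeven : Even V.natDegree) (hVdeg : 2 ≤ V.natDegree)
    (hVlead : 0 < V.leadingCoeff)
    (hint : ∀ q : Polynomial ℝ,
      Integrable (fun x : ℝ => q.eval x * Real.exp (-(V.eval x))))
    (p : ℕ → Polynomial ℝ)
    (hmonic : ∀ n, (p n).Monic)
    (hpdeg : ∀ n, (p n).natDegree = n)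
    (horth : ∀ n m, n ≠ m →
      ∫ x : ℝ, (p n).eval x * (p m).eval x * Real.exp (-(V.eval x)) = 0)
    (h : ℕ → ℝ)
    (hh : ∀ n, h n = ∫ x : ℝ, ((p n).eval x) ^ 2 * Real.exp (-(V.eval x)))
    (hhpos : ∀ n, 0 < h n)
    (ψ : ℕ → ℝ → ℝ)
    (hψ : ∀ n x, ψ n x = (p n).eval x * Real.exp (-(V.eval x) / 2) / Real.sqrt (h n))
    (n m : ℕ) :
    (n ≤ m → ∫ x : ℝ, deriv (ψ n) x * ψ m x
        = -(1 / 2) * ∫ x : ℝ, (derivative V).eval x * ψ n x * ψ m x) ∧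
    (m ≤ n → ∫ x : ℝ, deriv (ψ n) x * ψ m x
        = (1 / 2) * ∫ x : ℝ, (derivative V).eval x * ψ n x * ψ m x) := by
  have hlow : ∀ {i j : ℕ}, i ≤ j →
      ∫ x : ℝ, (derivative (p i) * p j).eval x * Real.exp (-(V.eval x)) = 0 := by
    intro i j hij
    refine integral_mul_orthogonal_eq_zero V hint p hmonic hpdeg horth le_rfl _ ?_
    refine (degree_derivative_lt (hmonic i).ne_zero).trans_le ?_
    rw [degree_eq_natDegree (hmonic i).ne_zero, hpdeg]
    exact_mod_cast hij
  have hexp : ∀ x : ℝ, Real.exp (-(V.eval x))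
      = Real.exp (-(V.eval x) / 2) * Real.exp (-(V.eval x) / 2) := by
    intro x
    rw [← Real.exp_add]
    ring_nf
  have hderivψ : ∀ x : ℝ, deriv (ψ n) x
      = ((derivative (p n)).eval x - 1 / 2 * ((derivative V).eval x * (p n).eval x))
        * Real.exp (-(V.eval x) / 2) / Real.sqrt (h n) := by
    intro x
    rw [show ψ n = _ from funext (hψ n)]
    refine HasDerivAt.deriv ?_
    refine ((((p n).hasDerivAt x).mul
      ((V.hasDerivAt x).neg.div_const 2).exp).div_const (Real.sqrt (h n))).congr_deriv ?_
    simp only [Pi.neg_apply]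
    ring
  set c : ℝ := (Real.sqrt (h n))⁻¹ * (Real.sqrt (h m))⁻¹ with hc
  set A := ∫ x : ℝ, (derivative (p n) * p m).eval x * Real.exp (-(V.eval x)) with hA
  set B := ∫ x : ℝ, (derivative V * (p n * p m)).eval x * Real.exp (-(V.eval x)) with hB
  have hleft : ∫ x : ℝ, deriv (ψ n) x * ψ m x = c * (A - 1 / 2 * B) := by
    rw [hA, hB, ← integral_const_mul, ← integral_sub (hint _) ((hint _).const_mul _),
      ← integral_const_mul]
    congr 1
    funext x
    rw [hderivψ, hψ, hexp]
    simp only [eval_mul, hc, div_eq_mul_inv]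
    ring
  have hright : ∫ x : ℝ, (derivative V).eval x * ψ n x * ψ m x = c * B := by
    rw [hB, ← integral_const_mul]
    congr 1
    funext x
    rw [hψ, hψ, hexp]
    simp only [eval_mul, hc, div_eq_mul_inv]
    ring
  rw [hleft, hright]
  constructor
  · intro hnm
    rw [show A = 0 from hlow hnm]
    ring
  · intro hmn
    have hparts : B = A + ∫ x : ℝ, (derivative (p m) * p n).eval x * Real.exp (-(V.eval x)) := by
      rw [hB, ← integral_derivative_mul_exp_neg V hint, hA, ← integral_add (hint _) (hint _)]
      congr 1
      funext x
      simp only [derivative_mul, eval_add, eval_mul]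
      ring
    rw [hlow hmn, add_zero] at hparts
    rw [hparts]
    ring
end

section
/- For every n ∈ ℕ and every x ∈ ℝ, V'(x) ψ_n(x) = Σ_{k=1}^{d} ( η_{k,n} ψ_{n+k}(x) + η_{k,n−k} ψ_{n−k}(x) ), where d = deg V − 1 and the terms with n − k < 0 are omitted; here η_{k,j} = ∫_ℝ V'(t) ψ_j(t) ψ_{j+k}(t) dt. -/
open MeasureTheory Polynomial Real

/-- The linear functional `q ↦ ∫ q e^{-V}` on polynomials, for an integrable weight. -/
noncomputable def weightFunctional (V : ℝ[X])
    (hint : ∀ q : ℝ[X], Integrable (fun x : ℝ => q.eval x * Real.exp (-(V.eval x)))) :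
    ℝ[X] →ₗ[ℝ] ℝ where
  toFun q := ∫ x : ℝ, q.eval x * Real.exp (-(V.eval x))
  map_add' q r := by
    simp only [eval_add, add_mul]
    exact integral_add (hint q) (hint r)
  map_smul' c q := by
    simp only [eval_smul, smul_eq_mul, mul_assoc, RingHom.id_apply]
    exact integral_const_mul c _

theorem weightFunctional_apply (V : ℝ[X])
    (hint : ∀ q : ℝ[X], Integrable (fun x : ℝ => q.eval x * Real.exp (-(V.eval x))))
    (q : ℝ[X]) :
    weightFunctional V hint q = ∫ x : ℝ, q.eval x * Real.exp (-(V.eval x)) := rfl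

/-- Integration by parts against the weight `e^{-V}`. -/
theorem weightFunctional_derivative (V : ℝ[X])
    (hint : ∀ q : ℝ[X], Integrable (fun x : ℝ => q.eval x * Real.exp (-(V.eval x))))
    (q : ℝ[X]) :
    weightFunctional V hint (derivative V * q) = weightFunctional V hint (derivative q) := by
  rw [eq_comm, ← sub_eq_zero, ← map_sub]
  refine integral_eq_zero_of_hasDerivAt_of_integrable
    (f := fun x => q.eval x * Real.exp (-(V.eval x))) (fun x => ?_) (hint _) (hint q)
  refine ((q.hasDerivAt x).mul (V.hasDerivAt x).neg.exp).congr_deriv ?_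
  simp only [eval_sub, eval_mul, Pi.neg_apply]
  ring

/-- A monic sequence with one polynomial in each degree spans all polynomials. -/
theorem exists_eq_sum_of_monic {p : ℕ → ℝ[X]} (hmonic : ∀ n, (p n).Monic)
    (hpdeg : ∀ n, (p n).natDegree = n) (N : ℕ) (q : ℝ[X]) (hq : q.degree < N) :
    ∃ c : ℕ → ℝ, q = ∑ j ∈ Finset.range N, c j • p j := by
  induction N generalizing q with
  | zero => exact ⟨0, by simpa using hq⟩
  | succ N ih =>
    obtain ⟨c, hc⟩ := ih (q - q.coeff N • p N) <| by
      rw [degree_lt_iff_coeff_zero] at hq ⊢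
      intro m hm
      have hN : (p N).coeff N = 1 := by simpa [hpdeg] using (hmonic N).coeff_natDegree
      rcases hm.eq_or_lt with rfl | hlt
      · simp [hN]
      · rw [coeff_sub, coeff_smul, hq m hlt,
          coeff_eq_zero_of_natDegree_lt ((hpdeg N).trans_lt hlt)]
        simp
    refine ⟨fun j => if j = N then q.coeff N else c j, ?_⟩
    rw [Finset.sum_range_succ, Finset.sum_congr rfl (g := fun j => c j • p j), ← hc]
    · simp
    · intro j hj
      simp [(Finset.mem_range.mp hj).ne]

theorem map_mul_eq_zero_of_degree_lt {p : ℕ → ℝ[X]} (hmonic : ∀ n, (p n).Monic)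
    (hpdeg : ∀ n, (p n).natDegree = n) (L : ℝ[X] →ₗ[ℝ] ℝ)
    (horth : ∀ n m, n ≠ m → L (p n * p m) = 0) (N : ℕ) (q : ℝ[X]) (hq : q.degree < N) :
    L (q * p N) = 0 := by
  obtain ⟨c, rfl⟩ := exists_eq_sum_of_monic hmonic hpdeg N q hq
  rw [Finset.sum_mul, map_sum]
  refine Finset.sum_eq_zero fun j hj => ?_
  rw [smul_mul_assoc, map_smul, horth j N (Finset.mem_range.mp hj).ne, smul_zero]

theorem eq_sum_of_orthogonal {p : ℕ → ℝ[X]} (hmonic : ∀ n, (p n).Monic)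
    (hpdeg : ∀ n, (p n).natDegree = n) (L : ℝ[X] →ₗ[ℝ] ℝ)
    (horth : ∀ n m, n ≠ m → L (p n * p m) = 0) (hpos : ∀ n, L (p n * p n) ≠ 0)
    (N : ℕ) (q : ℝ[X]) (hq : q.degree < N) :
    q = ∑ j ∈ Finset.range N, (L (q * p j) / L (p j * p j)) • p j := by
  obtain ⟨c, hc⟩ := exists_eq_sum_of_monic hmonic hpdeg N q hq
  conv_lhs => rw [hc]
  refine Finset.sum_congr rfl fun j hj => ?_
  have : L (q * p j) = c j * L (p j * p j) := by
    rw [hc, Finset.sum_mul, map_sum, Finset.sum_eq_single_of_mem j hj]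
    · rw [smul_mul_assoc, map_smul, smul_eq_mul]
    · intro i _ hij
      rw [smul_mul_assoc, map_smul, horth i j hij, smul_zero]
  rw [this, mul_div_cancel_right₀ _ (hpos j)]

theorem sum_range_add_eq_sum_symm (f : ℕ → ℝ) (n d : ℕ) :
    ∑ j ∈ Finset.range (n + d + 1), f j = ∑ j ∈ Finset.range (n - d), f j + f n +
      ∑ k ∈ Finset.Icc 1 d, (f (n + k) + if k ≤ n then f (n - k) else 0) := by
  induction d with
  | zero => simp [Finset.sum_range_succ]
  | succ d ih =>
    rw [Finset.sum_Icc_succ_top (by omega), ← add_assoc n d 1, Finset.sum_range_succ, ih]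
    split_ifs with hd
    · rw [show n - d = n - (d + 1) + 1 by omega, Finset.sum_range_succ]
      ring
    · rw [show n - d = n - (d + 1) by omega]
      ring

theorem stmt5
    (V : Polynomial ℝ)
    (hVeven : Even V.natDegree) (hVdeg : 2 ≤ V.natDegree)
    (hVlead : 0 < V.leadingCoeff)
    (hint : ∀ q : Polynomial ℝ,
      Integrable (fun x : ℝ => q.eval x * Real.exp (-(V.eval x))))
    (p : ℕ → Polynomial ℝ)
    (hmonic : ∀ n, (p n).Monic)
    (hpdeg : ∀ n, (p n).natDegree = n)
    (horth : ∀ n m, n ≠ m →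
      ∫ x : ℝ, (p n).eval x * (p m).eval x * Real.exp (-(V.eval x)) = 0)
    (h : ℕ → ℝ)
    (hh : ∀ n, h n = ∫ x : ℝ, ((p n).eval x) ^ 2 * Real.exp (-(V.eval x)))
    (hhpos : ∀ n, 0 < h n)
    (ψ : ℕ → ℝ → ℝ)
    (hψ : ∀ n x, ψ n x = (p n).eval x * Real.exp (-(V.eval x) / 2) / Real.sqrt (h n))
    (η : ℕ → ℕ → ℝ)
    (hη : ∀ k j, η k j = ∫ t : ℝ, (derivative V).eval t * ψ j t * ψ (j + k) t)
    (n : ℕ) (x : ℝ) :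
    (derivative V).eval x * ψ n x
      = ∑ k ∈ Finset.Icc 1 (V.natDegree - 1),
          (η k n * ψ (n + k) x + if k ≤ n then η k (n - k) * ψ (n - k) x else 0) := by
  set L := weightFunctional V hint with hL
  have hLorth : ∀ n m, n ≠ m → L (p n * p m) = 0 := fun n m hnm => by
    simpa [hL, weightFunctional_apply] using horth n m hnm
  have hLh : ∀ n, L (p n * p n) = h n := fun n => by
    simp [hL, weightFunctional_apply, hh, pow_two]
  have hsq : ∀ j, √(h j) * √(h j) = h j := fun j => Real.mul_self_sqrt (hhpos j).le
  have hsq0 : ∀ j, √(h j) ≠ 0 := fun j => (Real.sqrt_pos.mpr (hhpos j)).ne'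
  have hG : ∀ i j, ∫ t : ℝ, (derivative V).eval t * ψ i t * ψ j t
      = L (derivative V * p i * p j) / (√(h i) * √(h j)) := fun i j => by
    rw [hL, weightFunctional_apply, ← integral_div]
    congr 1 with t
    have he : Real.exp (-(V.eval t)) = Real.exp (-(V.eval t) / 2) * Real.exp (-(V.eval t) / 2) := by
      rw [← Real.exp_add, add_halves]
    rw [hψ, hψ, he, eval_mul, eval_mul]
    have := hsq0 i
    have := hsq0 j
    field_simp
  have hdegp : ∀ j, (p j).degree = j := fun j => by
    rw [degree_eq_natDegree (hmonic j).ne_zero, hpdeg]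
  have hdegV : (derivative V).degree ≤ (V.natDegree - 1 : ℕ) :=
    degree_le_of_natDegree_le (natDegree_derivative_le V)
  have hdeg : ∀ j, (derivative V * p j).degree < (j + (V.natDegree - 1) + 1 : ℕ) := fun j => by
    refine (degree_mul_le _ _).trans_lt ?_
    rw [hdegp]
    refine (add_le_add_left hdegV _).trans_lt ?_
    norm_cast
    omega
  have hdiag : L (derivative V * p n * p n) = 0 := by
    rw [mul_assoc, hL, weightFunctional_derivative, ← hL, derivative_mul, map_add,
      mul_comm (p n), ← two_mul, map_mul_eq_zero_of_degree_lt hmonic hpdeg L hLorth, mul_zero]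
    exact (degree_derivative_lt (hmonic n).ne_zero).trans_eq (hdegp n)
  have hlow : ∀ j, j + (V.natDegree - 1) < n → L (derivative V * p n * p j) = 0 := fun j hj => by
    rw [mul_right_comm]
    exact map_mul_eq_zero_of_degree_lt hmonic hpdeg L hLorth n _
      ((hdeg j).trans_le (by exact_mod_cast hj))
  have hexp := congrArg (eval x) (eq_sum_of_orthogonal hmonic hpdeg L hLorth
    (fun j => by rw [hLh]; exact (hhpos j).ne') _ _ (hdeg n))
  rw [eval_mul, eval_finsetSum] at hexp
  have hψsum : (derivative V).eval x * ψ n x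
      = ∑ j ∈ Finset.range (n + (V.natDegree - 1) + 1),
          L (derivative V * p n * p j) / (√(h n) * √(h j)) * ψ j x := by
    rw [hψ, mul_div_assoc, ← mul_assoc, hexp, Finset.sum_mul]
    refine Finset.sum_congr rfl fun j _ => ?_
    have hdiv : L (derivative V * p n * p j) / h j
        = L (derivative V * p n * p j) / (√(h j) * √(h j)) := by rw [hsq]
    rw [eval_smul, smul_eq_mul, hLh, hψ, hdiv]
    have := hsq0 n
    have := hsq0 j
    field_simp
  rw [hψsum, sum_range_add_eq_sum_symm, hdiag, Finset.sum_eq_zero fun j hj => by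
    rw [hlow j (by have := Finset.mem_range.mp hj; omega), zero_div, zero_mul]]
  rw [zero_div, zero_mul, add_zero, zero_add]
  refine Finset.sum_congr rfl fun k _ => ?_
  rw [hη, hη, hG, hG]
  split_ifs with hk
  · rw [Nat.sub_add_cancel hk, mul_right_comm _ (p (n - k)), mul_comm √(h (n - k))]
  · rfl
end

section
/- For every n ≥ 1 and every x ∈ ℝ: 1 = (β_n − x)( γ_{n+1} R_{n,n+1}(x) − γ_n R_{n,n−1}(x) ) + γ_{n+1}² R_{n+1,n+1}(x) − γ_n² R_{n−1,n−1}(x). -/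
open MeasureTheory Polynomial Real

/-- The moment functional `q ↦ ∫ q exp(-V)`. -/
noncomputable def momentFunctional (V : ℝ[X])
    (hint : ∀ q : ℝ[X], Integrable (fun x : ℝ => q.eval x * Real.exp (-(V.eval x)))) :
    ℝ[X] →ₗ[ℝ] ℝ where
  toFun q := ∫ x : ℝ, q.eval x * Real.exp (-(V.eval x))
  map_add' q r := by
    simp only [eval_add, add_mul]
    exact integral_add (hint q) (hint r)
  map_smul' c q := by
    simp only [eval_smul, smul_eq_mul, mul_assoc, RingHom.id_apply]
    exact integral_const_mul c _

/-- Integration by parts for the moment functional. -/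
lemma momentFunctional_derivative (V : ℝ[X])
    (hint : ∀ q : ℝ[X], Integrable (fun x : ℝ => q.eval x * Real.exp (-(V.eval x))))
    (q : ℝ[X]) :
    momentFunctional V hint (derivative V * q) = momentFunctional V hint (derivative q) := by
  have hderiv : ∀ x : ℝ, HasDerivAt (fun x : ℝ => q.eval x * Real.exp (-(V.eval x)))
      ((derivative q - derivative V * q).eval x * Real.exp (-(V.eval x))) x := by
    intro x
    refine ((q.hasDerivAt x).mul (V.hasDerivAt x).neg.exp).congr_deriv ?_
    simp only [eval_sub, eval_mul, Pi.neg_apply]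
    ring
  have hzero : momentFunctional V hint (derivative q - derivative V * q) = 0 :=
    integral_eq_zero_of_hasDerivAt_of_integrable hderiv (hint _) (hint q)
  rw [map_sub] at hzero
  linarith

section OrthogonalPolynomials

variable {L : ℝ[X] →ₗ[ℝ] ℝ} {p : ℕ → ℝ[X]} {h : ℕ → ℝ}

lemma degree_sub_coeff_mul_lt {p : ℝ[X]} (hp : p.Monic) {k : ℕ} (hdeg : p.natDegree = k)
    {q : ℝ[X]} (hq : q.degree < ((k + 1 : ℕ) : WithBot ℕ)) :
    (q - C (q.coeff k) * p).degree < (k : WithBot ℕ) := by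
  rw [degree_lt_iff_coeff_zero] at hq ⊢
  intro m hm
  rcases hm.eq_or_lt with rfl | hlt
  · have : p.coeff k = 1 := by rw [← hdeg]; exact hp
    simp [this]
  · rw [coeff_sub, coeff_C_mul, hq m hlt, coeff_eq_zero_of_natDegree_lt (hdeg.trans_lt hlt)]
    simp

lemma orthogonal_eq_zero_of_degree_lt (hmonic : ∀ n, (p n).Monic)
    (hpdeg : ∀ n, (p n).natDegree = n) (horth : ∀ n m, n ≠ m → L (p n * p m) = 0)
    {n : ℕ} {q : ℝ[X]} (hq : q.degree < (n : WithBot ℕ)) : L (p n * q) = 0 := by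
  suffices H : ∀ k ≤ n, ∀ q : ℝ[X], q.degree < (k : WithBot ℕ) → L (p n * q) = 0 from
    H n le_rfl q hq
  intro k
  induction k with
  | zero =>
    intro _ q hq
    have : q = 0 := by
      rw [← degree_eq_bot]
      simpa using hq
    simp [this]
  | succ k ih =>
    intro hk q hq
    have hlow := ih (by omega) _ (degree_sub_coeff_mul_lt (hmonic k) (hpdeg k) hq)
    have hsplit : p n * q = p n * (q - C (q.coeff k) * p k) + q.coeff k • (p n * p k) := by
      rw [smul_eq_C_mul]
      ring
    rw [hsplit, map_add, map_smul, hlow, horth n k (by omega)]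
    simp

lemma orthogonal_eq_coeff_mul (hmonic : ∀ n, (p n).Monic)
    (hpdeg : ∀ n, (p n).natDegree = n) (horth : ∀ n m, n ≠ m → L (p n * p m) = 0)
    (hnorm : ∀ n, L (p n * p n) = h n)
    {n : ℕ} {q : ℝ[X]} (hq : q.degree < ((n + 1 : ℕ) : WithBot ℕ)) :
    L (p n * q) = q.coeff n * h n := by
  have hsplit : p n * q = p n * (q - C (q.coeff n) * p n) + q.coeff n • (p n * p n) := by
    rw [smul_eq_C_mul]
    ring
  rw [hsplit, map_add, map_smul, hnorm, orthogonal_eq_zero_of_degree_lt hmonic hpdeg horth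
    (degree_sub_coeff_mul_lt (hmonic n) (hpdeg n) hq)]
  simp

lemma eq_zero_of_orthogonal (hmonic : ∀ n, (p n).Monic)
    (hpdeg : ∀ n, (p n).natDegree = n) (horth : ∀ n m, n ≠ m → L (p n * p m) = 0)
    (hnorm : ∀ n, L (p n * p n) = h n) (hhpos : ∀ n, 0 < h n)
    {k : ℕ} {r : ℝ[X]} (hr : r.degree < (k : WithBot ℕ))
    (hzero : ∀ m < k, L (p m * r) = 0) : r = 0 := by
  by_contra hne
  have hlt : r.natDegree < k := (natDegree_lt_iff_degree_lt hne).2 hr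
  have hcoeff := orthogonal_eq_coeff_mul hmonic hpdeg horth hnorm (n := r.natDegree) (q := r)
    ((natDegree_lt_iff_degree_lt hne).1 (Nat.lt_succ_self _))
  rw [hzero _ hlt] at hcoeff
  have := mul_ne_zero (leadingCoeff_ne_zero.2 hne) (hhpos r.natDegree).ne'
  exact this hcoeff.symm

/-- The three-term recurrence. -/
lemma three_term_recurrence (hmonic : ∀ n, (p n).Monic)
    (hpdeg : ∀ n, (p n).natDegree = n) (horth : ∀ n m, n ≠ m → L (p n * p m) = 0)
    (hnorm : ∀ n, L (p n * p n) = h n) (hhpos : ∀ n, 0 < h n)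
    (k : ℕ) {b : ℝ} (hb : L (X * p (k + 1) ^ 2) = b * h (k + 1)) :
    X * p (k + 1) = p (k + 2) + C b * p (k + 1) + C (h (k + 1) / h k) * p k := by
  have hcoeff : ∀ m, (p m).coeff m = 1 := fun m => by
    simpa [hpdeg m] using (hmonic m).coeff_natDegree
  have hhigh : ∀ m j, m < j → (p m).coeff j = 0 := fun m j hj =>
    coeff_eq_zero_of_natDegree_lt ((hpdeg m).symm ▸ hj)
  rw [← sub_eq_zero]
  refine eq_zero_of_orthogonal hmonic hpdeg horth hnorm hhpos (k := k + 2) ?_ ?_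
  · rw [degree_lt_iff_coeff_zero]
    intro m hm
    obtain ⟨m, rfl⟩ : ∃ j, m = j + 1 := ⟨m - 1, by omega⟩
    rw [coeff_sub, coeff_X_mul, coeff_add, coeff_add, coeff_C_mul, coeff_C_mul,
      hhigh (k + 1) (m + 1) (by omega), hhigh k (m + 1) (by omega)]
    rcases (show k + 1 ≤ m by omega).eq_or_lt with rfl | hlt
    · simp [hcoeff]
    · simp [hhigh (k + 1) m hlt, hhigh (k + 2) (m + 1) (by omega)]
  · intro m hm
    have hsplit : p m * (X * p (k + 1)
          - (p (k + 2) + C b * p (k + 1) + C (h (k + 1) / h k) * p k))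
        = X * p (k + 1) * p m - p m * p (k + 2) - b • (p m * p (k + 1))
          - (h (k + 1) / h k) • (p m * p k) := by
      simp only [smul_eq_C_mul]
      ring
    rw [hsplit, map_sub, map_sub, map_sub, map_smul, map_smul, horth m (k + 2) (by omega)]
    rcases (show m ≤ k + 1 by omega).eq_or_lt with rfl | hlt
    · rw [horth (k + 1) k (by omega), hnorm,
        show X * p (k + 1) * p (k + 1) = X * p (k + 1) ^ 2 by ring, hb]
      simp
    · have hX : L (X * p (k + 1) * p m) = (X * p m).coeff (k + 1) * h (k + 1) := by
        rw [show X * p (k + 1) * p m = p (k + 1) * (X * p m) by ring]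
        refine orthogonal_eq_coeff_mul hmonic hpdeg horth hnorm ?_
        rw [degree_lt_iff_coeff_zero]
        intro j hj
        obtain ⟨j, rfl⟩ : ∃ i, j = i + 1 := ⟨j - 1, by omega⟩
        rw [coeff_X_mul, hhigh m j (by omega)]
      rw [hX, coeff_X_mul, horth m (k + 1) (by omega)]
      rcases (show m ≤ k by omega).eq_or_lt with rfl | hlt'
      · have := (hhpos m).ne'
        rw [hcoeff, hnorm, smul_eq_mul, smul_eq_mul]
        field_simp
        ring
      · rw [hhigh m k hlt', horth m k (by omega)]
        simp

lemma orthogonal_derivative_mul_succ (hmonic : ∀ n, (p n).Monic)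
    (hpdeg : ∀ n, (p n).natDegree = n) (horth : ∀ n m, n ≠ m → L (p n * p m) = 0)
    (hnorm : ∀ n, L (p n * p n) = h n) (n : ℕ) :
    L (derivative (p n * p (n + 1))) = (n + 1) * h n := by
  have hlow : L (p (n + 1) * derivative (p n)) = 0 := by
    refine orthogonal_eq_zero_of_degree_lt hmonic hpdeg horth ?_
    rw [degree_lt_iff_coeff_zero]
    intro m hm
    rw [coeff_derivative, coeff_eq_zero_of_natDegree_lt (by rw [hpdeg]; omega), zero_mul]
  have htop : L (p n * derivative (p (n + 1)))
      = (derivative (p (n + 1))).coeff n * h n := by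
    refine orthogonal_eq_coeff_mul hmonic hpdeg horth hnorm ?_
    rw [degree_lt_iff_coeff_zero]
    intro m hm
    rw [coeff_derivative, coeff_eq_zero_of_natDegree_lt (by rw [hpdeg]; omega), zero_mul]
  have hlead : (p (n + 1)).coeff (n + 1) = 1 := by
    simpa [hpdeg (n + 1)] using (hmonic (n + 1)).coeff_natDegree
  rw [derivative_mul, map_add, htop, mul_comm, hlow, coeff_derivative, hlead]
  ring

/-- The string-type identity for the difference quotient `W` of `V'`, in monic normalization. -/
lemma orthogonal_string_identity (hmonic : ∀ n, (p n).Monic)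
    (hpdeg : ∀ n, (p n).natDegree = n) (horth : ∀ n m, n ≠ m → L (p n * p m) = 0)
    (hnorm : ∀ n, L (p n * p n) = h n) (hhpos : ∀ n, 0 < h n)
    {V : ℝ[X]} (hparts : ∀ q, L (derivative V * q) = L (derivative q))
    {W : ℝ[X]} {x v : ℝ} (hW : (X - C x) * W = derivative V - C v)
    (k : ℕ) {a b : ℝ} (ha : a = h (k + 1) / h k) (hb : L (X * p (k + 1) ^ 2) = b * h (k + 1)) :
    h (k + 1) = (b - x) * (L (W * p (k + 1) * p (k + 2)) - a * L (W * p (k + 1) * p k))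
      + L (W * p (k + 2) * p (k + 2)) - a ^ 2 * L (W * p k * p k) := by
  have hrec := three_term_recurrence hmonic hpdeg horth hnorm hhpos k hb
  rw [← ha] at hrec
  have hpoly : (b - x) • (W * p (k + 1) * p (k + 2)) - ((b - x) * a) • (W * p (k + 1) * p k)
        + W * p (k + 2) * p (k + 2) - (a ^ 2) • (W * p k * p k)
      = derivative V * (p (k + 1) * p (k + 2)) - a • (derivative V * (p k * p (k + 1)))
        - v • (p (k + 1) * p (k + 2)) + (v * a) • (p k * p (k + 1)) := by
    simp only [smul_eq_C_mul, C_sub, C_mul, C_pow]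
    linear_combination (p (k + 1) * (p (k + 2) - C a * p k)) * hW
      - W * (p (k + 2) - C a * p k) * hrec
  have hL := congrArg L hpoly
  simp only [map_add, map_sub, map_smul, smul_eq_mul, hparts,
    orthogonal_derivative_mul_succ hmonic hpdeg horth hnorm,
    horth (k + 1) (k + 2) (by omega), horth k (k + 1) (by omega)] at hL
  have hak : a * h k = h (k + 1) := by
    rw [ha, div_mul_cancel₀ _ (hhpos k).ne']
  push_cast at hL
  linear_combination (-1) * hL + (k + 1) * hak

end OrthogonalPolynomials

theorem stmt10
    (V : Polynomial ℝ)
    (hVeven : Even V.natDegree) (hVdeg : 2 ≤ V.natDegree)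
    (hVlead : 0 < V.leadingCoeff)
    (hint : ∀ q : Polynomial ℝ,
      Integrable (fun x : ℝ => q.eval x * Real.exp (-(V.eval x))))
    (p : ℕ → Polynomial ℝ)
    (hmonic : ∀ n, (p n).Monic)
    (hpdeg : ∀ n, (p n).natDegree = n)
    (horth : ∀ n m, n ≠ m →
      ∫ x : ℝ, (p n).eval x * (p m).eval x * Real.exp (-(V.eval x)) = 0)
    (h : ℕ → ℝ)
    (hh : ∀ n, h n = ∫ x : ℝ, ((p n).eval x) ^ 2 * Real.exp (-(V.eval x)))
    (hhpos : ∀ n, 0 < h n)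
    (ψ : ℕ → ℝ → ℝ)
    (hψ : ∀ n x, ψ n x = (p n).eval x * Real.exp (-(V.eval x) / 2) / Real.sqrt (h n))
    (γ : ℕ → ℝ)
    (hγ : ∀ n, 1 ≤ n → γ n = Real.sqrt (h n / h (n - 1)))
    (β : ℕ → ℝ)
    (hβ : ∀ n, β n = ∫ x : ℝ, x * (ψ n x) ^ 2)
    (W : ℝ → Polynomial ℝ)
    (hW : ∀ x : ℝ, (X - C x) * W x = derivative V - C ((derivative V).eval x))
    (R : ℕ → ℕ → ℝ → ℝ)
    (hR : ∀ i j (x : ℝ), R i j x = ∫ t : ℝ, (W x).eval t * ψ i t * ψ j t)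
    (n : ℕ) (hn : 1 ≤ n) (x : ℝ) :
    (1 : ℝ)
      = (β n - x) * (γ (n + 1) * R n (n + 1) x - γ n * R n (n - 1) x)
        + (γ (n + 1)) ^ 2 * R (n + 1) (n + 1) x
        - (γ n) ^ 2 * R (n - 1) (n - 1) x := by
  obtain ⟨k, rfl⟩ : ∃ k, n = k + 1 := ⟨n - 1, by omega⟩
  simp only [Nat.add_sub_cancel]
  set L := momentFunctional V hint
  have hLapp : ∀ q, L q = ∫ t : ℝ, q.eval t * Real.exp (-(V.eval t)) := fun _ => rfl
  have horthL : ∀ n m, n ≠ m → L (p n * p m) = 0 := fun n m hnm => by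
    simpa only [hLapp, eval_mul] using horth n m hnm
  have hnormL : ∀ n, L (p n * p n) = h n := fun n => by
    simp only [hLapp, hh, eval_mul, pow_two]
  have hweight : ∀ (q : ℝ[X]) i j,
      ∫ t : ℝ, q.eval t * ψ i t * ψ j t = L (q * p i * p j) / (√(h i) * √(h j)) := by
    intro q i j
    rw [hLapp, ← integral_div]
    refine integral_congr_ae (.of_forall fun t => ?_)
    have hexp : Real.exp (-(V.eval t))
        = Real.exp (-(V.eval t) / 2) * Real.exp (-(V.eval t) / 2) := by
      rw [← Real.exp_add, add_halves]
    simp only [hψ, eval_mul, hexp]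
    ring
  have hbL : L (X * p (k + 1) ^ 2) = β (k + 1) * h (k + 1) := by
    have hβw := hweight X (k + 1) (k + 1)
    rw [Real.mul_self_sqrt (hhpos _).le] at hβw
    have : β (k + 1) = L (X * p (k + 1) * p (k + 1)) / h (k + 1) := by
      rw [hβ, ← hβw]
      simp only [eval_X, pow_two, mul_assoc]
    rw [this, div_mul_cancel₀ _ (hhpos _).ne', pow_two, mul_assoc]
  have key := orthogonal_string_identity hmonic hpdeg horthL hnormL hhpos
    (momentFunctional_derivative V hint) (hW x) k rfl hbL
  rw [hγ (k + 1) (by omega), hγ (k + 1 + 1) (by omega)]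
  simp only [Nat.add_sub_cancel, hR, hweight]
  rw [Real.sqrt_div (hhpos _).le, Real.sqrt_div (hhpos _).le]
  have hsq : ∀ i, ∃ s, 0 < s ∧ √(h i) = s ∧ h i = s ^ 2 := fun i =>
    ⟨√(h i), Real.sqrt_pos.2 (hhpos i), rfl, (Real.sq_sqrt (hhpos i).le).symm⟩
  obtain ⟨s₀, hs₀, hr₀, he₀⟩ := hsq k
  obtain ⟨s₁, hs₁, hr₁, he₁⟩ := hsq (k + 1)
  obtain ⟨s₂, hs₂, hr₂, he₂⟩ := hsq (k + 2)
  rw [he₀, he₁] at key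
  rw [hr₀, hr₁, hr₂]
  have hs₁' := hs₁.ne'
  have hs₀' := hs₀.ne'
  have hs₂' := hs₂.ne'
  rw [← mul_left_inj' (pow_ne_zero 2 hs₁'), one_mul]
  refine key.trans ?_
  field_simp
end

section
/- For every u ∈ U, every k with 1 ≤ k ≤ D, and all n, m ∈ ℕ with m > n: the partial derivative ∂ψ_n/∂u_k exists and ∫_ℝ (∂ψ_n/∂u_k)(u, x) ψ_m(u, x) dx = −(1/(2k)) ∫_ℝ x^k ψ_n(u, x) ψ_m(u, x) dx; moreover ∫_ℝ (∂ψ_n/∂u_k)(u, x) ψ_n(u, x) dx = 0. (In matrix form, U_k = −(1/(2k))((Q^k)_+ − (Q^k)_−).) -/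
open MeasureTheory Polynomial Real

theorem exp_neg_mul_le_add_of_abs_le {s c ε : ℝ} (hs : |s| ≤ ε) :
    exp (-(s * c)) ≤ exp (-(ε * c)) + exp (-(-ε * c)) := by
  obtain ⟨h1, h2⟩ := abs_le.mp hs
  rcases le_total 0 c with hc | hc
  · have : exp (-(s * c)) ≤ exp (-(-ε * c)) := exp_le_exp.mpr (by nlinarith)
    linarith [exp_pos (-(ε * c))]
  · have : exp (-(s * c)) ≤ exp (-(ε * c)) := exp_le_exp.mpr (by nlinarith)
    linarith [exp_pos (-(-ε * c))]

theorem hasDerivAt_moment {W : ℝ → ℝ} {t₀ c ε : ℝ} {k : ℕ} (hε : 0 < ε)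
    (hint : ∀ t, |t - t₀| ≤ ε → ∀ q : ℝ[X],
      Integrable (fun x => q.eval x * exp (-(W x + (t - t₀) * (c * x ^ k))))) (j : ℕ) :
    HasDerivAt (fun t => ∫ x, x ^ j * exp (-(W x + (t - t₀) * (c * x ^ k))))
      (∫ x, -(c * x ^ k) * x ^ j * exp (-W x)) t₀ := by
  have hint' : ∀ t, |t - t₀| ≤ ε →
      Integrable (fun x => x ^ j * exp (-(W x + (t - t₀) * (c * x ^ k)))) := fun t ht => by
    simpa using hint t ht (X ^ j)
  have hint'' : ∀ t, |t - t₀| ≤ ε →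
      Integrable (fun x => -(c * x ^ k) * x ^ j * exp (-(W x + (t - t₀) * (c * x ^ k)))) :=
    fun t ht => by
      have h1 := hint t ht (-(C c * X ^ k) * X ^ j)
      simpa only [eval_mul, eval_neg, eval_C, eval_pow, eval_X] using h1
  have hp : |t₀ + ε - t₀| ≤ ε := by simp [abs_of_pos hε]
  have hm : |t₀ - ε - t₀| ≤ ε := by simp [abs_of_pos hε]
  have h0 : |t₀ - t₀| ≤ ε := by simpa using hε.le
  have key := hasDerivAt_integral_of_dominated_loc_of_deriv_le (μ := volume) (𝕜 := ℝ)
    (F := fun t x => x ^ j * exp (-(W x + (t - t₀) * (c * x ^ k))))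
    (F' := fun t x => -(c * x ^ k) * x ^ j * exp (-(W x + (t - t₀) * (c * x ^ k))))
    (x₀ := t₀) (s := Metric.ball t₀ ε)
    (bound := fun x => ‖-(c * x ^ k) * x ^ j * exp (-(W x + (t₀ + ε - t₀) * (c * x ^ k)))‖ +
      ‖-(c * x ^ k) * x ^ j * exp (-(W x + (t₀ - ε - t₀) * (c * x ^ k)))‖)
    (Metric.ball_mem_nhds t₀ hε) ?_ (hint' t₀ h0) (hint'' t₀ h0).aestronglyMeasurable ?_
    ((hint'' _ hp).norm.add (hint'' _ hm).norm) ?_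
  · simpa using key.2
  · filter_upwards [Metric.ball_mem_nhds t₀ hε] with t ht
    exact (hint' t (by simpa [Real.dist_eq] using (Metric.mem_ball.mp ht).le)).aestronglyMeasurable
  · refine Filter.Eventually.of_forall fun x t ht => ?_
    have ht' : |t - t₀| ≤ ε := by simpa [Real.dist_eq] using (Metric.mem_ball.mp ht).le
    have hb := exp_neg_mul_le_add_of_abs_le (c := c * x ^ k) ht'
    have hs : ∀ s : ℝ, exp (-(W x + s * (c * x ^ k))) =
        exp (-W x) * exp (-(s * (c * x ^ k))) := fun s => by rw [← exp_add]; ring_nf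
    simp only [hs]
    have hn : ∀ a r s : ℝ, ‖a * (exp r * exp s)‖ = ‖a‖ * (exp r * exp s) := fun a r s => by
      rw [norm_mul, norm_of_nonneg (mul_pos (exp_pos r) (exp_pos s)).le]
    rw [hn, hn, hn, ← mul_add, ← mul_add]
    have e1 : t₀ + ε - t₀ = ε := by ring
    have e2 : t₀ - ε - t₀ = -ε := by ring
    rw [e1, e2]
    gcongr
  · refine Filter.Eventually.of_forall fun x t _ => ?_
    have h1 : HasDerivAt (fun t => -(W x + (t - t₀) * (c * x ^ k))) (-(c * x ^ k)) t :=
      ((((hasDerivAt_id t).sub_const t₀).mul_const (c * x ^ k)).const_add (W x)).neg.congr_deriv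
        (by ring)
    exact (h1.exp.const_mul (x ^ j)).congr_deriv (by ring)

theorem hasDerivAt_integral_eval {W : ℝ → ℝ} {t₀ c ε : ℝ} {k N : ℕ} (hε : 0 < ε)
    (hint : ∀ t, |t - t₀| ≤ ε → ∀ q : ℝ[X],
      Integrable (fun x => q.eval x * exp (-(W x + (t - t₀) * (c * x ^ k)))))
    {P : ℝ → ℝ[X]} {P' : ℝ[X]} (hN : ∀ᶠ t in nhds t₀, (P t).natDegree < N)
    (hN' : P'.natDegree < N)
    (hP : ∀ j, HasDerivAt (fun t => (P t).coeff j) (P'.coeff j) t₀) :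
    HasDerivAt (fun t => ∫ x, (P t).eval x * exp (-(W x + (t - t₀) * (c * x ^ k))))
      (∫ x, (P' - C c * X ^ k * P t₀).eval x * exp (-W x)) t₀ := by
  have hnear : ∀ᶠ t in nhds t₀, |t - t₀| ≤ ε := by
    filter_upwards [Metric.ball_mem_nhds t₀ hε] with t ht
    simpa [Real.dist_eq] using (Metric.mem_ball.mp ht).le
  have h0 : |t₀ - t₀| ≤ ε := by simpa using hε.le
  have hint0 : ∀ q : ℝ[X], Integrable (fun x => q.eval x * exp (-W x)) := fun q => by
    simpa using hint t₀ h0 q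
  have hsum := HasDerivAt.fun_sum (u := Finset.range N)
    fun j _ => (hP j).mul (hasDerivAt_moment hε hint j)
  refine (hsum.congr_of_eventuallyEq ?_).congr_deriv ?_
  · filter_upwards [hN, hnear] with t ht hte
    simp only [eval_eq_sum_range' ht, Finset.sum_mul, Pi.mul_apply]
    rw [integral_finsetSum]
    · simp only [mul_assoc, integral_const_mul]
    · intro j _
      have h1 := hint t hte (C ((P t).coeff j) * X ^ j)
      simpa only [eval_mul, eval_C, eval_pow, eval_X] using h1
  · simp only [eval_sub, eval_mul, eval_C, eval_pow, eval_X, eval_eq_sum_range' hN',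
      eval_eq_sum_range' hN.self_of_nhds, sub_self, zero_mul, add_zero]
    have : ∀ x : ℝ, (∑ j ∈ Finset.range N, P'.coeff j * x ^ j -
        c * x ^ k * ∑ j ∈ Finset.range N, (P t₀).coeff j * x ^ j) * exp (-W x) =
        ∑ j ∈ Finset.range N, (P'.coeff j * (x ^ j * exp (-W x)) +
          (P t₀).coeff j * (-(c * x ^ k) * x ^ j * exp (-W x))) := fun x => by
      rw [Finset.mul_sum, ← Finset.sum_sub_distrib, Finset.sum_mul]
      exact Finset.sum_congr rfl fun j _ => by ring
    simp only [this]
    have i1 : ∀ j, Integrable fun x => P'.coeff j * (x ^ j * exp (-W x)) := fun j => by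
      simpa using (hint0 (X ^ j)).const_mul (P'.coeff j)
    have i2 : ∀ j, Integrable fun x =>
        (P t₀).coeff j * (-(c * x ^ k) * x ^ j * exp (-W x)) := fun j => by
      have h1 := (hint0 (-(C c * X ^ k) * X ^ j)).const_mul ((P t₀).coeff j)
      simpa only [eval_mul, eval_neg, eval_C, eval_pow, eval_X] using h1
    rw [integral_finsetSum _ fun j _ => by exact (i1 j).add (i2 j)]
    refine Finset.sum_congr rfl fun j _ => ?_
    rw [integral_add (i1 j) (i2 j), integral_const_mul, integral_const_mul]

theorem integral_eval_mul_eq_zero_of_degree_lt {w : ℝ → ℝ} {p : ℕ → ℝ[X]}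
    (hint : ∀ q : ℝ[X], Integrable (fun x => q.eval x * w x))
    (hmonic : ∀ n, (p n).Monic) (hdeg : ∀ n, (p n).natDegree = n)
    (horth : ∀ n m, n ≠ m → ∫ x, (p n).eval x * (p m).eval x * w x = 0)
    {m : ℕ} {q : ℝ[X]} (hq : q.degree < m) :
    ∫ x, q.eval x * (p m).eval x * w x = 0 := by
  suffices H : ∀ N ≤ m, ∀ q : ℝ[X], q.degree < N →
      ∫ x, q.eval x * (p m).eval x * w x = 0 from H m le_rfl q hq
  intro N
  induction N with
  | zero =>
    intro _ q hq
    have : q = 0 := by simpa [degree_lt_iff_coeff_zero, Polynomial.ext_iff] using hq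
    simp [this]
  | succ N ih =>
    intro hN q hq
    have hr : (q - C (q.coeff N) * p N).degree < N := by
      rw [degree_lt_iff_coeff_zero] at hq ⊢
      intro j hj
      rcases hj.eq_or_lt with rfl | hj
      · have : (p N).coeff N = 1 := by simpa [hdeg N] using (hmonic N).coeff_natDegree
        simp [this]
      · have h1 : (p N).coeff j = 0 := coeff_eq_zero_of_natDegree_lt (by rwa [hdeg N])
        simp [hq j hj, h1]
    have h1 := ih (by omega) _ hr
    have h2 := horth N m (by omega)
    have i1 : Integrable fun x => (q - C (q.coeff N) * p N).eval x * (p m).eval x * w x := by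
      simpa only [eval_mul] using hint ((q - C (q.coeff N) * p N) * p m)
    have i2 : Integrable fun x => q.coeff N * ((p N).eval x * (p m).eval x * w x) := by
      simpa only [eval_mul] using (hint (p N * p m)).const_mul (q.coeff N)
    have : ∀ x, q.eval x * (p m).eval x * w x =
        (q - C (q.coeff N) * p N).eval x * (p m).eval x * w x +
          q.coeff N * ((p N).eval x * (p m).eval x * w x) := fun x => by
      simp only [eval_sub, eval_mul, eval_C]; ring
    simp only [this]
    rw [integral_add i1 i2, integral_const_mul, h1, h2]
    simp

theorem hasDerivAt_coeff_sq {P : ℝ → ℝ[X]} {P' : ℝ[X]} {t₀ : ℝ}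
    (hP : ∀ j, HasDerivAt (fun t => (P t).coeff j) (P'.coeff j) t₀) (j : ℕ) :
    HasDerivAt (fun t => (P t ^ 2).coeff j) ((P' * P t₀ + P t₀ * P').coeff j) t₀ := by
  simp only [pow_two, coeff_mul, coeff_add, ← Finset.sum_add_distrib]
  exact HasDerivAt.fun_sum fun a _ => (hP a.1).mul (hP a.2)

theorem stmt12
    (D : ℕ) (hDeven : Even D) (hD2 : 2 ≤ D)
    (U : Set (Fin D → ℝ)) (hUopen : IsOpen U)
    (hUpos : ∀ u ∈ U, 0 < u ⟨D - 1, by omega⟩)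
    (Vf : (Fin D → ℝ) → ℝ → ℝ)
    (hVf : ∀ (u : Fin D → ℝ) (x : ℝ),
      Vf u x = ∑ i : Fin D, u i / ((i : ℕ) + 1) * x ^ ((i : ℕ) + 1))
    (hint : ∀ u ∈ U, ∀ q : Polynomial ℝ,
      Integrable (fun x : ℝ => q.eval x * Real.exp (-(Vf u x))))
    (p : (Fin D → ℝ) → ℕ → Polynomial ℝ)
    (hmonic : ∀ u ∈ U, ∀ n, (p u n).Monic)
    (hpdeg : ∀ u ∈ U, ∀ n, (p u n).natDegree = n)
    (horth : ∀ u ∈ U, ∀ n m, n ≠ m →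
      ∫ x : ℝ, (p u n).eval x * (p u m).eval x * Real.exp (-(Vf u x)) = 0)
    (h : (Fin D → ℝ) → ℕ → ℝ)
    (hh : ∀ (u : Fin D → ℝ) (n : ℕ),
      h u n = ∫ x : ℝ, ((p u n).eval x) ^ 2 * Real.exp (-(Vf u x)))
    (hhpos : ∀ u ∈ U, ∀ n, 0 < h u n)
    (ψ : (Fin D → ℝ) → ℕ → ℝ → ℝ)
    (hψ : ∀ (u : Fin D → ℝ) (n : ℕ) (x : ℝ),
      ψ u n x = (p u n).eval x * Real.exp (-(Vf u x) / 2) / Real.sqrt (h u n))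
    (hcoeff : ∀ n j, DifferentiableOn ℝ (fun u => (p u n).coeff j) U)
    (u : Fin D → ℝ) (hu : u ∈ U) (i : Fin D) (n m : ℕ) (hnm : n < m) :
    (∀ x : ℝ, DifferentiableAt ℝ (fun t => ψ (Function.update u i t) n x) (u i)) ∧
    (∫ x : ℝ, deriv (fun t => ψ (Function.update u i t) n x) (u i) * ψ u m x
        = -(1 / (2 * ((i : ℕ) + 1 : ℝ)))
            * ∫ x : ℝ, x ^ ((i : ℕ) + 1) * ψ u n x * ψ u m x) ∧
    (∫ x : ℝ, deriv (fun t => ψ (Function.update u i t) n x) (u i) * ψ u n x = 0) := by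
  set k : ℕ := (i : ℕ) + 1 with hk
  set c : ℝ := 1 / (k : ℝ) with hc
  have hcast : ((i : ℕ) + 1 : ℝ) = k := by simp [hk]
  have hupd : Function.update u i (u i) = u := Function.update_eq_self i u
  have hV : ∀ t x, Vf (Function.update u i t) x = Vf u x + (t - u i) * (c * x ^ k) := by
    intro t x
    rw [hVf, hVf, ← sub_eq_iff_eq_add', ← Finset.sum_sub_distrib,
      Finset.sum_eq_single i (fun j _ hj => by simp [Function.update_of_ne hj]) (by simp)]
    simp only [Function.update_self, hc, hcast]
    ring
  have hUnhds : U ∈ nhds (Function.update u i (u i)) := by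
    rw [hupd]; exact hUopen.mem_nhds hu
  have hmem : ∀ᶠ t in nhds (u i), Function.update u i t ∈ U :=
    (continuous_const.update i continuous_id).continuousAt.eventually_mem hUnhds
  obtain ⟨ε, hε, hball⟩ := Metric.nhds_basis_closedBall.eventually_iff.mp hmem
  have hintt : ∀ t, |t - u i| ≤ ε → ∀ q : ℝ[X],
      Integrable (fun x => q.eval x * exp (-(Vf u x + (t - u i) * (c * x ^ k)))) := by
    intro t ht q
    simpa only [hV] using hint _ (hball (by simpa [Real.dist_eq] using ht)) q
  have hcd : ∀ j, DifferentiableAt ℝ (fun t => (p (Function.update u i t) n).coeff j) (u i) := by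
    intro j
    have h1 : DifferentiableAt ℝ (fun v => (p v n).coeff j) (Function.update u i (u i)) := by
      rw [hupd]; exact (hcoeff n j).differentiableAt (hUopen.mem_nhds hu)
    exact h1.comp (u i) (hasDerivAt_update u i (u i)).differentiableAt
  set P' : ℝ[X] := ∑ j ∈ Finset.range n,
    C (deriv (fun t => (p (Function.update u i t) n).coeff j) (u i)) * X ^ j with hP'
  have hP'coeff : ∀ j, P'.coeff j = if j < n then
      deriv (fun t => (p (Function.update u i t) n).coeff j) (u i) else 0 := by
    intro j
    simp [hP', coeff_C_mul, coeff_X_pow]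
  have hP'deg : P'.degree < n := by
    rw [degree_lt_iff_coeff_zero]
    intro j hj
    simp [hP'coeff, not_lt.mpr hj]
  have hP : ∀ j, HasDerivAt (fun t => (p (Function.update u i t) n).coeff j)
      (P'.coeff j) (u i) := by
    intro j
    rw [hP'coeff]
    split_ifs with hj
    · exact (hcd j).hasDerivAt
    · refine (hasDerivAt_const (u i) ((p u n).coeff j)).congr_of_eventuallyEq ?_
      filter_upwards [hmem] with t ht
      rcases (not_lt.mp hj).eq_or_lt with rfl | hj
      · have h1 := (hmonic _ ht n).coeff_natDegree
        have h2 := (hmonic _ hu n).coeff_natDegree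
        rw [hpdeg _ ht] at h1
        rw [hpdeg _ hu] at h2
        rw [h1, h2]
      · rw [coeff_eq_zero_of_natDegree_lt (by rwa [hpdeg _ ht]),
          coeff_eq_zero_of_natDegree_lt (by rwa [hpdeg _ hu])]
  have hPeval : ∀ x, HasDerivAt (fun t => (p (Function.update u i t) n).eval x)
      (P'.eval x) (u i) := by
    intro x
    have hlt : P'.natDegree < n + 1 :=
      Nat.lt_succ_of_le (natDegree_le_of_degree_le hP'deg.le)
    rw [eval_eq_sum_range' hlt]
    refine (HasDerivAt.fun_sum fun j _ => (hP j).mul_const (x ^ j)).congr_of_eventuallyEq ?_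
    filter_upwards [hmem] with t ht
    rw [eval_eq_sum_range' (by rw [hpdeg _ ht]; exact Nat.lt_succ_self n)]
  set w : ℝ → ℝ := fun x => exp (-Vf u x) with hw
  have hintw : ∀ q : ℝ[X], Integrable (fun x => q.eval x * w x) := hint u hu
  have horthw : ∀ {l : ℕ} {q : ℝ[X]}, q.degree < l →
      ∫ x, q.eval x * (p u l).eval x * w x = 0 := fun hq =>
    integral_eval_mul_eq_zero_of_degree_lt hintw (hmonic u hu) (hpdeg u hu) (horth u hu) hq
  have hnn := hhpos u hu n
  have hhd : HasDerivAt (fun t => h (Function.update u i t) n)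
      (-c * ∫ x, x ^ k * (p u n).eval x * (p u n).eval x * w x) (u i) := by
    have h1 := hasDerivAt_integral_eval (N := 2 * n + 1) (P := fun t =>
      p (Function.update u i t) n ^ 2) hε hintt ?_ ?_ (hasDerivAt_coeff_sq hP)
    · simp only [hh, hV]
      simp only [eval_pow] at h1
      refine h1.congr_deriv ?_
      simp only [hupd]
      have i1 := hintw (P' * p u n)
      have i2 := hintw (X ^ k * p u n * p u n)
      simp only [eval_mul, eval_pow, eval_X] at i1 i2
      have : ∀ x, (P' * p u n + p u n * P' - C c * X ^ k * p u n ^ 2).eval x * w x =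
          2 * (P'.eval x * (p u n).eval x * w x) +
            -c * (x ^ k * (p u n).eval x * (p u n).eval x * w x) := fun x => by
        simp only [eval_sub, eval_add, eval_mul, eval_pow, eval_C, eval_X]; ring
      change ∫ x, (P' * p u n + p u n * P' - C c * X ^ k * p u n ^ 2).eval x * w x = _
      simp only [this]
      rw [integral_add (i1.const_mul 2) (i2.const_mul (-c)), integral_const_mul,
        integral_const_mul, horthw hP'deg]
      ring
    · filter_upwards [hmem] with t ht
      rw [(hmonic _ ht n).natDegree_pow, hpdeg _ ht]
      omega
    · have hle : P'.natDegree ≤ n := natDegree_le_of_degree_le hP'deg.le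
      have hpn : (p u n).natDegree ≤ n := (hpdeg u hu n).le
      rw [hupd]
      refine Nat.lt_succ_of_le (natDegree_add_le_of_degree_le ?_ ?_) <;>
        exact natDegree_mul_le.trans (by omega)
  set J : ℝ := ∫ x, x ^ k * (p u n).eval x * (p u n).eval x * w x with hJ
  have hψd : ∀ x, HasDerivAt (fun t => ψ (Function.update u i t) n x)
      (P'.eval x * exp (-Vf u x / 2) / √(h u n) - c / 2 * x ^ k * ψ u n x
        + c * J / (2 * h u n) * ψ u n x) (u i) := by
    intro x
    simp only [hψ, hV]
    have hE : HasDerivAt (fun t => exp (-(Vf u x + (t - u i) * (c * x ^ k)) / 2))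
        (exp (-Vf u x / 2) * (-(c * x ^ k) / 2)) (u i) := by
      have h1 : HasDerivAt (fun t => -(Vf u x + (t - u i) * (c * x ^ k)) / 2)
          (-(c * x ^ k) / 2) (u i) := by
        simpa using (((((hasDerivAt_id (u i)).sub_const (u i)).mul_const
          (c * x ^ k)).const_add (Vf u x)).neg).div_const 2
      simpa using h1.exp
    have hs := hhd.sqrt (by rw [hupd]; exact hnn.ne')
    have hsq : √(h u n) ≠ 0 := (Real.sqrt_pos.mpr hnn).ne'
    refine (((hPeval x).mul hE).div hs (by rw [hupd]; exact hsq)).congr_deriv ?_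
    simp only [hupd, sub_self, zero_mul, add_zero, Pi.mul_apply]
    have hsq2 : h u n = √(h u n) ^ 2 := (Real.sq_sqrt hnn.le).symm
    generalize √(h u n) = r at *
    rw [hsq2]
    field_simp
    ring
  have hexp : ∀ x, exp (-Vf u x / 2) * exp (-Vf u x / 2) = w x := fun x => by
    rw [← exp_add, hw]; ring_nf
  have hψψ : ∀ l x, ψ u n x * ψ u l x =
      (√(h u n) * √(h u l))⁻¹ * ((p u n).eval x * (p u l).eval x * w x) := fun l x => by
    rw [hψ, hψ, ← hexp]; ring
  have hmain : ∀ l, n ≤ l →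
      ∫ x, deriv (fun t => ψ (Function.update u i t) n x) (u i) * ψ u l x =
        -(c / 2) * (∫ x, x ^ k * ψ u n x * ψ u l x)
          + c * J / (2 * h u n) * ∫ x, ψ u n x * ψ u l x := by
    intro l hl
    have i1 := (hintw (P' * p u l)).const_mul (√(h u n) * √(h u l))⁻¹
    have i2 := (hintw (X ^ k * p u n * p u l)).const_mul (√(h u n) * √(h u l))⁻¹
    have i3 := (hintw (p u n * p u l)).const_mul (√(h u n) * √(h u l))⁻¹
    simp only [eval_mul, eval_pow, eval_X] at i1 i2 i3
    have e2 : ∀ x, x ^ k * ψ u n x * ψ u l x = (√(h u n) * √(h u l))⁻¹ *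
        (x ^ k * (p u n).eval x * (p u l).eval x * w x) := fun x => by
      rw [mul_assoc, hψψ]; ring
    have e1 : ∀ x, deriv (fun t => ψ (Function.update u i t) n x) (u i) * ψ u l x =
        (√(h u n) * √(h u l))⁻¹ * (P'.eval x * (p u l).eval x * w x) +
          (-(c / 2) * (x ^ k * ψ u n x * ψ u l x) +
            c * J / (2 * h u n) * (ψ u n x * ψ u l x)) := fun x => by
      rw [(hψd x).deriv]
      have : P'.eval x * exp (-Vf u x / 2) / √(h u n) * ψ u l x =
          (√(h u n) * √(h u l))⁻¹ * (P'.eval x * (p u l).eval x * w x) := by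
        rw [hψ, ← hexp]; ring
      rw [← this]; ring
    simp only [← e2] at i2
    simp only [← hψψ] at i3
    simp only [e1]
    have i23 : Integrable fun x => -(c / 2) * (x ^ k * ψ u n x * ψ u l x) +
        c * J / (2 * h u n) * (ψ u n x * ψ u l x) := (i2.const_mul _).add (i3.const_mul _)
    rw [integral_add i1 i23,
      integral_add (i2.const_mul _) (i3.const_mul _), integral_const_mul, integral_const_mul,
      integral_const_mul, horthw (hP'deg.trans_le (by exact_mod_cast hl))]
    ring
  refine ⟨fun x => (hψd x).differentiableAt, ?_, ?_⟩
  · have h0 : ∫ x, ψ u n x * ψ u m x = 0 := by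
      simp only [hψψ]
      rw [integral_const_mul, horth u hu n m hnm.ne, mul_zero]
    rw [hmain m hnm.le, h0, hcast, hc]
    ring
  · have hr : (√(h u n) * √(h u n))⁻¹ = (h u n)⁻¹ := by rw [Real.mul_self_sqrt hnn.le]
    have h1 : ∫ x, ψ u n x * ψ u n x = 1 := by
      simp only [hψψ]
      have : ∫ x, (p u n).eval x * (p u n).eval x * w x = h u n := by
        rw [hh]; simp only [pow_two, hw]
      rw [integral_const_mul, this, hr, inv_mul_cancel₀ hnn.ne']
    have h2 : ∫ x, x ^ k * ψ u n x * ψ u n x = (h u n)⁻¹ * J := by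
      rw [hJ, ← integral_const_mul, ← hr]
      congr 1
      ext x
      rw [mul_assoc, hψψ]; ring
    rw [hmain n le_rfl, h1, h2]
    field_simp
    ring
end
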